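/- Let X = {G ∈ H^∞(𝔻) : G(0) = 0, G'(0) = 1/2} and for G₁, G₂ ∈ H^∞ let N(G₁,G₂) = sup_{w∈𝔻} σ_max([[1, G₂(w)], [G₁(w), 1]]). Then the infimum of N(G₁,G₂) over pairs G₁, G₂ ∈ X that are rational functions equals √2, even though no rational pair attains it. -/

import Mathlib

open Complex Metric

/-- The largest singular value of a 2×2 complex matrix. -/
noncomputable def sigmaMax (M : Matrix (Fin 2) (Fin 2) ℂ) : ℝ :=
  ‖Matrix.toEuclideanCLM (𝕜 := ℂ) M‖

/-- Membership in X: bounded holomorphic on the disc, G(0)=0, G'(0)=1/2. -/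
def memX (G : ℂ → ℂ) : Prop :=
  DifferentiableOn ℂ G (ball (0 : ℂ) 1) ∧
  (∃ C : ℝ, ∀ w ∈ ball (0 : ℂ) 1, ‖G w‖ ≤ C) ∧
  G 0 = 0 ∧ deriv G 0 = 1 / 2

/-- G agrees on the disc with a quotient of polynomials (no poles in the disc). -/
def isRational (G : ℂ → ℂ) : Prop :=
  ∃ P Q : Polynomial ℂ, (∀ w ∈ ball (0 : ℂ) 1, Q.eval w ≠ 0) ∧
    ∀ w ∈ ball (0 : ℂ) 1, G w = P.eval w / Q.eval w

/-- The model matching cost N(G₁,G₂) = sup over the disc of σ_max([[1,G₂],[G₁,1]]). -/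
noncomputable def matchCost (G₁ G₂ : ℂ → ℂ) : ℝ :=
  sSup ((fun w : ℂ => sigmaMax !![1, G₂ w; G₁ w, 1]) '' ball (0 : ℂ) 1)

lemma norm_toEuclideanCLM_offDiag_apply_sq (a b : ℂ) (x : EuclideanSpace ℂ (Fin 2)) :
    ‖Matrix.toEuclideanCLM (𝕜 := ℂ) !![1, b; a, 1] x‖ ^ 2 =
      ‖x 0 + b * x 1‖ ^ 2 + ‖a * x 0 + x 1‖ ^ 2 := by
  rw [EuclideanSpace.norm_sq_eq, Fin.sum_univ_two, Matrix.ofLp_toEuclideanCLM]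
  simp [Matrix.mulVec, dotProduct, Fin.sum_univ_two]

lemma sigmaMax_offDiag_le {a b : ℂ} {K : ℝ} (hK : 0 ≤ K)
    (h : ∀ x y : ℂ, ‖x + b * y‖ ^ 2 + ‖a * x + y‖ ^ 2 ≤ K ^ 2 * (‖x‖ ^ 2 + ‖y‖ ^ 2)) :
    sigmaMax !![1, b; a, 1] ≤ K := by
  refine ContinuousLinearMap.opNorm_le_bound _ hK fun x => ?_
  refine (sq_le_sq₀ (norm_nonneg _) (by positivity)).mp ?_
  rw [norm_toEuclideanCLM_offDiag_apply_sq, mul_pow, EuclideanSpace.norm_sq_eq x,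
    Fin.sum_univ_two]
  exact h _ _

lemma norm_sq_add_norm_sq_le_of_sigmaMax_le {a b : ℂ} {K : ℝ}
    (h : sigmaMax !![1, b; a, 1] ≤ K) (x y : ℂ) :
    ‖x + b * y‖ ^ 2 + ‖a * x + y‖ ^ 2 ≤ K ^ 2 * (‖x‖ ^ 2 + ‖y‖ ^ 2) := by
  have h1 := ContinuousLinearMap.le_of_opNorm_le _ h (!₂[x, y] : EuclideanSpace ℂ (Fin 2))
  have h2 := pow_le_pow_left₀ (norm_nonneg _) h1 2
  rw [norm_toEuclideanCLM_offDiag_apply_sq, mul_pow, EuclideanSpace.norm_sq_eq,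
    Fin.sum_univ_two] at h2
  simpa using h2

lemma sigmaMax_symm_le {g : ℂ} {K : ℝ} (h₁ : ‖1 + g‖ ≤ K) (h₂ : ‖1 - g‖ ≤ K) :
    sigmaMax !![1, g; g, 1] ≤ K := by
  have hK : 0 ≤ K := (norm_nonneg _).trans h₁
  refine sigmaMax_offDiag_le hK fun x y => ?_
  have e1 := parallelogram_law_with_norm ℂ (x + g * y) (g * x + y)
  have e2 := parallelogram_law_with_norm ℂ x y
  have f1 : x + g * y + (g * x + y) = (1 + g) * (x + y) := by ring
  have f2 : x + g * y - (g * x + y) = (1 - g) * (x - y) := by ring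
  rw [f1, f2, norm_mul, norm_mul] at e1
  have k1 : (‖1 + g‖ * ‖x + y‖) * (‖1 + g‖ * ‖x + y‖) ≤ K ^ 2 * (‖x + y‖ * ‖x + y‖) := by
    rw [mul_mul_mul_comm, sq]; gcongr
  have k2 : (‖1 - g‖ * ‖x - y‖) * (‖1 - g‖ * ‖x - y‖) ≤ K ^ 2 * (‖x - y‖ * ‖x - y‖) := by
    rw [mul_mul_mul_comm, sq]; gcongr
  nlinarith

lemma sigmaMax_offDiag_le_of_norm_le {a b : ℂ} {C : ℝ} (ha : ‖a‖ ≤ C) (hb : ‖b‖ ≤ C) :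
    sigmaMax !![1, b; a, 1] ≤ 2 * (1 + C) := by
  have hC : 0 ≤ C := (norm_nonneg _).trans ha
  refine sigmaMax_offDiag_le (by positivity) fun x y => ?_
  have h1 : ‖x + b * y‖ ≤ ‖x‖ + C * ‖y‖ := (norm_add_le _ _).trans (by rw [norm_mul]; gcongr)
  have h2 : ‖a * x + y‖ ≤ C * ‖x‖ + ‖y‖ := (norm_add_le _ _).trans (by rw [norm_mul]; gcongr)
  have h3 := pow_le_pow_left₀ (norm_nonneg _) h1 2
  have h4 := pow_le_pow_left₀ (norm_nonneg _) h2 2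
  nlinarith [sq_nonneg (‖x‖ - C * ‖y‖), sq_nonneg (C * ‖x‖ - ‖y‖),
    mul_nonneg hC (sq_nonneg ‖x‖), mul_nonneg hC (sq_nonneg ‖y‖), sq_nonneg (C * ‖x‖),
    sq_nonneg (C * ‖y‖), sq_nonneg ‖x‖, sq_nonneg ‖y‖]

lemma four_mul_norm_mul_le_of_sigmaMax_le {a b : ℂ} (h : sigmaMax !![1, b; a, 1] ≤ √2) :
    4 * ‖a * b‖ ≤ ‖1 - a * b‖ ^ 2 := by
  have key := norm_sq_add_norm_sq_le_of_sigmaMax_le h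
  rw [Real.sq_sqrt (by norm_num : (0 : ℝ) ≤ 2)] at key
  have ha := key 1 0
  have hb := key 0 1
  simp only [mul_zero, mul_one, add_zero, zero_add, norm_one, norm_zero] at ha hb
  have hc : ∀ t : ℝ, 0 ≤ (1 - ‖b‖ ^ 2) * (t * t) + (-2 * ‖b + star a‖ ^ 2) * t +
      (1 - ‖a‖ ^ 2) * ‖b + star a‖ ^ 2 := by
    intro t
    have := key (b + star a) t
    simp only [Complex.sq_norm, Complex.normSq_apply] at this ⊢
    simp at this ⊢
    nlinarith
  have hd := discrim_le_zero hc
  rw [discrim] at hd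
  have hdet : ‖b + star a‖ ^ 2 ≤ (1 - ‖a‖ ^ 2) * (1 - ‖b‖ ^ 2) := by
    rcases (sq_nonneg ‖b + star a‖).eq_or_lt with h0 | h0
    · rw [← h0]; exact mul_nonneg (by linarith) (by linarith)
    · refine le_of_mul_le_mul_left ?_ h0
      linarith
  have hid : ‖1 - a * b‖ ^ 2 - 2 * (‖a‖ ^ 2 + ‖b‖ ^ 2) =
      (1 - ‖a‖ ^ 2) * (1 - ‖b‖ ^ 2) - ‖b + star a‖ ^ 2 := by
    simp only [Complex.sq_norm, Complex.normSq_apply]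
    simp
    ring
  rw [norm_mul]
  nlinarith [sq_nonneg (‖a‖ - ‖b‖)]

lemma bddAbove_sigmaMax_image {G₁ G₂ : ℂ → ℂ} (h₁ : memX G₁) (h₂ : memX G₂) :
    BddAbove ((fun w : ℂ => sigmaMax !![1, G₂ w; G₁ w, 1]) '' ball (0 : ℂ) 1) := by
  obtain ⟨-, ⟨C₁, hC₁⟩, -⟩ := h₁
  obtain ⟨-, ⟨C₂, hC₂⟩, -⟩ := h₂
  refine ⟨2 * (1 + max C₁ C₂), ?_⟩
  rintro _ ⟨w, hw, rfl⟩
  exact sigmaMax_offDiag_le_of_norm_le ((hC₁ w hw).trans (le_max_left _ _))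
    ((hC₂ w hw).trans (le_max_right _ _))

lemma norm_le_of_norm_mul_le {H : ℂ → ℂ} {C : ℝ} (hH : DifferentiableOn ℂ H (ball 0 1))
    (hC : ∀ w ∈ ball (0 : ℂ) 1, ‖w * H w‖ ≤ C) : ∀ w ∈ ball (0 : ℂ) 1, ‖H w‖ ≤ C := by
  intro w hw
  have h := norm_dslope_le_div_of_mapsTo_ball (f := fun w => w * H w) (c := 0) (R₁ := 1)
    (R₂ := C) (differentiableOn_id.mul hH) (fun z hz => by simpa using hC z hz) hw
  have e : dslope (fun w => w * H w) 0 w = H w := by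
    rcases eq_or_ne w 0 with rfl | hne
    · rw [dslope_same]
      have h0 := (hH.differentiableAt (isOpen_ball.mem_nhds hw)).hasDerivAt
      simpa using ((hasDerivAt_id' (0 : ℂ)).fun_mul h0).deriv
    · simpa using dslope_sub_smul_of_ne (a := 0) H hne
  rwa [e, div_one] at h

lemma X_sq_add_one_mul_sq_ne_sq {R Q : Polynomial ℂ} (hQ : Q ≠ 0) :
    R ^ 2 ≠ Polynomial.C 4 * (Polynomial.X ^ 2 + 1) * Q ^ 2 := by
  intro h
  have hfac : (Polynomial.X ^ 2 + 1 : Polynomial ℂ) =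
      (Polynomial.X - Polynomial.C I) * (Polynomial.X - Polynomial.C (-I)) := by
    have : (Polynomial.C I * Polynomial.C I : Polynomial ℂ) = -1 := by
      rw [← Polynomial.C_mul, I_mul_I]; simp
    rw [Polynomial.C_neg]
    linear_combination this
  have h4 : (Polynomial.C 4 : Polynomial ℂ) ≠ 0 := by simp
  have hX : ∀ a : ℂ, (Polynomial.X - Polynomial.C a : Polynomial ℂ) ≠ 0 :=
    Polynomial.X_sub_C_ne_zero
  have hne : Polynomial.C 4 * (Polynomial.X ^ 2 + 1) * Q ^ 2 ≠ 0 := by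
    rw [hfac]
    exact mul_ne_zero (mul_ne_zero h4 (mul_ne_zero (hX _) (hX _))) (pow_ne_zero _ hQ)
  have hR : R * R ≠ 0 := by rwa [← sq, h]
  have hI : I ≠ -I := by
    intro h
    have := congrArg Complex.im h
    norm_num at this
  have hm := congrArg (Polynomial.rootMultiplicity I) h
  rw [hfac] at hne hm
  rw [Polynomial.rootMultiplicity_mul hne, Polynomial.rootMultiplicity_mul (left_ne_zero_of_mul hne),
    Polynomial.rootMultiplicity_mul (mul_ne_zero (hX _) (hX _)), Polynomial.rootMultiplicity_X_sub_C,
    Polynomial.rootMultiplicity_X_sub_C, Polynomial.rootMultiplicity_C, if_pos rfl, if_neg hI,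
    sq, sq, Polynomial.rootMultiplicity_mul hR,
    Polynomial.rootMultiplicity_mul (mul_ne_zero hQ hQ)] at hm
  omega

lemma four_mul_mul_eq_of_sigmaMax_le {G₁ G₂ : ℂ → ℂ} (h₁ : memX G₁) (h₂ : memX G₂)
    (h : ∀ w ∈ ball (0 : ℂ) 1, sigmaMax !![1, G₂ w; G₁ w, 1] ≤ √2) :
    ∀ w ∈ ball (0 : ℂ) 1, 4 * (G₁ w * G₂ w) = w ^ 2 * (1 - G₁ w * G₂ w) ^ 2 := by
  obtain ⟨hd₁, -, h0₁, h1₁⟩ := h₁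
  obtain ⟨hd₂, -, h0₂, h1₂⟩ := h₂
  have hnhds : ball (0 : ℂ) 1 ∈ nhds 0 := isOpen_ball.mem_nhds (by simp)
  have hmem : (0 : ℂ) ∈ ball (0 : ℂ) 1 := by simp
  have hs₁ := (Complex.differentiableOn_dslope hnhds).mpr hd₁
  have hs₂ := (Complex.differentiableOn_dslope hnhds).mpr hd₂
  have hG₁ : ∀ w, w * dslope G₁ 0 w = G₁ w := fun w => by
    simpa using sub_smul_dslope_of_zero h0₁ w
  have hG₂ : ∀ w, w * dslope G₂ 0 w = G₂ w := fun w => by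
    simpa using sub_smul_dslope_of_zero h0₂ w
  have hne : ∀ w ∈ ball (0 : ℂ) 1, 1 - G₁ w * G₂ w ≠ 0 := by
    intro w hw h0
    have := four_mul_norm_mul_le_of_sigmaMax_le (h w hw)
    rw [h0, ← sub_eq_zero.mp h0] at this
    norm_num at this
  set H : ℂ → ℂ := fun w => dslope G₁ 0 w * dslope G₂ 0 w / (1 - G₁ w * G₂ w) ^ 2 with hH
  have hHd : DifferentiableOn ℂ H (ball 0 1) :=
    (hs₁.mul hs₂).div (((differentiableOn_const 1).sub (hd₁.mul hd₂)).pow 2)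
      fun w hw => pow_ne_zero _ (hne w hw)
  have hwH : ∀ w, w * (w * H w) = G₁ w * G₂ w / (1 - G₁ w * G₂ w) ^ 2 := by
    intro w
    rw [← hG₁ w, ← hG₂ w, hH]
    simp only [← hG₁ w, ← hG₂ w]
    ring
  have hbound : ∀ w ∈ ball (0 : ℂ) 1, ‖H w‖ ≤ 1 / 4 := by
    refine norm_le_of_norm_mul_le hHd (norm_le_of_norm_mul_le (differentiableOn_id.mul hHd) ?_)
    intro w hw
    have hpos : 0 < ‖1 - G₁ w * G₂ w‖ := norm_pos_iff.mpr (hne w hw)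
    have := four_mul_norm_mul_le_of_sigmaMax_le (h w hw)
    change ‖w * (w * H w)‖ ≤ _
    rw [hwH, norm_div, norm_pow, div_le_iff₀ (by positivity)]
    linarith
  have hH0 : H 0 = 1 / 4 := by
    simp only [hH, dslope_same, h0₁, h1₁, h1₂]
    norm_num
  have hmax : IsMaxOn (norm ∘ H) (ball 0 1) 0 := by
    intro w hw
    simpa [hH0] using hbound w hw
  have hconst := Complex.eqOn_of_isPreconnected_of_isMaxOn_norm
    (convex_ball (0 : ℂ) 1).isPreconnected isOpen_ball hHd hmem hmax
  intro w hw
  have e := hwH w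
  rw [hconst hw, Function.const_apply, hH0, eq_div_iff (pow_ne_zero _ (hne w hw))] at e
  linear_combination -4 * e

lemma sqrt_two_lt_matchCost {G₁ G₂ : ℂ → ℂ} (r₁ : isRational G₁) (r₂ : isRational G₂)
    (h₁ : memX G₁) (h₂ : memX G₂) : √2 < matchCost G₁ G₂ := by
  by_contra! hle
  have heq := four_mul_mul_eq_of_sigmaMax_le h₁ h₂ fun w hw =>
    (le_csSup (bddAbove_sigmaMax_image h₁ h₂) ⟨w, hw, rfl⟩).trans hle
  obtain ⟨P₁, Q₁, hQ₁, hG₁⟩ := r₁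
  obtain ⟨P₂, Q₂, hQ₂, hG₂⟩ := r₂
  have hpoly : Polynomial.C 4 * (P₁ * P₂) * (Q₁ * Q₂) =
      Polynomial.X ^ 2 * (Q₁ * Q₂ - P₁ * P₂) ^ 2 := by
    refine Polynomial.eq_of_infinite_eval_eq _ _ (Set.Infinite.mono (s := ball (0 : ℂ) 1) ?_ ?_)
    · intro w hw
      have e := heq w hw
      have n₁ := hQ₁ w hw
      have n₂ := hQ₂ w hw
      rw [hG₁ w hw, hG₂ w hw] at e
      field_simp at e
      simp only [Set.mem_ofPred_eq, Polynomial.eval_mul, Polynomial.eval_C, Polynomial.eval_pow,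
        Polynomial.eval_X, Polynomial.eval_sub]
      linear_combination e
    · exact infinite_of_mem_nhds (0 : ℂ) (ball_mem_nhds _ one_pos)
  have hQ : Q₁ * Q₂ ≠ 0 := by
    intro h0
    have := congrArg (Polynomial.eval 0) h0
    simp [hQ₁ 0 (by simp), hQ₂ 0 (by simp)] at this
  refine X_sq_add_one_mul_sq_ne_sq (R := Polynomial.X ^ 2 * (P₁ * P₂) -
    (Polynomial.X ^ 2 + Polynomial.C 2) * (Q₁ * Q₂)) hQ ?_
  have h24 : (Polynomial.C 4 : Polynomial ℂ) = 4 := map_ofNat Polynomial.C 4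
  have h22 : (Polynomial.C 2 : Polynomial ℂ) = 2 := map_ofNat Polynomial.C 2
  rw [h24] at hpoly ⊢
  rw [h22]
  linear_combination -Polynomial.X ^ 2 * hpoly

/-- The value at `w` of the optimal function `(√(1 + w²) - 1) / w`. -/
lemma exists_optimal_value {w : ℂ} (hw : ‖w‖ ≤ 1) :
    ∃ F : ℂ, ‖F‖ ≤ 1 ∧ F * (2 + w * F) = w ∧ ‖1 + F‖ ≤ √2 ∧ ‖1 - F‖ ≤ √2 := by
  obtain ⟨s, hs, hre⟩ : ∃ s : ℂ, s ^ 2 = 1 + w ^ 2 ∧ 0 ≤ s.re := by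
    obtain ⟨s, hs⟩ := IsAlgClosed.exists_pow_nat_eq (1 + w ^ 2) (n := 2) (by norm_num)
    rcases le_total 0 s.re with h | h
    · exact ⟨s, hs, h⟩
    · exact ⟨-s, by rw [neg_sq, hs], by simpa using h⟩
  have h1 : 1 ≤ ‖1 + s‖ := by
    refine le_trans ?_ (Complex.re_le_norm _)
    simpa using hre
  have hne : 1 + s ≠ 0 := norm_pos_iff.mp (by linarith)
  have hF1 : ‖w / (1 + s)‖ ≤ 1 := by
    rw [norm_div]
    exact div_le_one_of_le₀ (hw.trans h1) (norm_nonneg _)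
  have hFw : w / (1 + s) * (2 + w * (w / (1 + s))) = w := by
    have hF : w / (1 + s) * (1 + s) = w := div_mul_cancel₀ w hne
    have hwF : w * (w / (1 + s)) = s - 1 :=
      mul_right_cancel₀ hne (by linear_combination w * hF - hs)
    rw [hwF]
    linear_combination hF
  set F := w / (1 + s)
  have h2 : 2 * ‖F‖ ≤ ‖1 - F ^ 2‖ := by
    have : 2 * F = w * (1 - F ^ 2) := by linear_combination hFw
    calc 2 * ‖F‖ = ‖2 * F‖ := by simp
      _ = ‖w‖ * ‖1 - F ^ 2‖ := by rw [this, norm_mul]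
      _ ≤ ‖1 - F ^ 2‖ := mul_le_of_le_one_left (norm_nonneg _) hw
  have h3 := pow_le_pow_left₀ (by positivity) h2 2
  have h4 := pow_le_pow_left₀ (norm_nonneg _) hF1 2
  have h5 : |2 * F.re| ≤ 1 - ‖F‖ ^ 2 := by
    refine abs_le_of_sq_le_sq ?_ (by linarith)
    rw [mul_pow] at h3
    simp only [Complex.sq_norm, Complex.normSq_apply] at h3 ⊢
    simp [sq] at h3 ⊢
    nlinarith
  obtain ⟨h6, h7⟩ := abs_le.mp h5
  refine ⟨F, hF1, hFw, Real.le_sqrt_of_sq_le ?_, Real.le_sqrt_of_sq_le ?_⟩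
  all_goals
    simp only [Complex.sq_norm, Complex.normSq_apply] at h6 h7 ⊢
    simp
    nlinarith

/-- Iterating the contraction `φ ↦ w / (2 + w φ)` gives rational approximations of the
optimal function on smaller discs. -/
lemma exists_rational_approx {r : ℝ} (hr : r < 1) (n : ℕ) :
    ∃ P Q : Polynomial ℂ, P.eval 0 = 0 ∧ 2 * P.derivative.eval 0 = Q.eval 0 ∧
      ∀ w : ℂ, ‖w‖ ≤ r → Q.eval w ≠ 0 ∧ ‖P.eval w / Q.eval w‖ ≤ 1 ∧
        ∀ F : ℂ, ‖F‖ ≤ 1 → F * (2 + w * F) = w →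
          ‖P.eval w / Q.eval w - F‖ ≤ 2 * (r ^ 2) ^ n := by
  have hden : ∀ w φ : ℂ, ‖w‖ ≤ r → ‖φ‖ ≤ 1 → 1 ≤ ‖2 + w * φ‖ := by
    intro w φ hw hφ
    have h1 : ‖w * φ‖ ≤ 1 := by
      rw [norm_mul]
      exact mul_le_one₀ (hw.trans hr.le) (norm_nonneg _) hφ
    have h2 := norm_sub_le (2 + w * φ) (w * φ)
    rw [add_sub_cancel_right] at h2
    norm_num at h2
    norm_num at h1
    linarith
  induction n with
  | zero =>
    refine ⟨Polynomial.X, Polynomial.C 2, by simp, by simp, fun w hw => ?_⟩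
    have h1 : ‖w / 2‖ ≤ 1 := by
      rw [norm_div]; norm_num; linarith
    refine ⟨by simp, by simpa using h1, fun F hF _ => ?_⟩
    simp only [Polynomial.eval_X, Polynomial.eval_C, pow_zero]
    linarith [norm_sub_le (w / 2) F]
  | succ n ih =>
    obtain ⟨P, Q, hP0, hP1, hPQ⟩ := ih
    refine ⟨Polynomial.X * Q, Polynomial.C 2 * Q + Polynomial.X * P, by simp, by simp,
      fun w hw => ?_⟩
    obtain ⟨hQ, hφ, hF⟩ := hPQ w hw
    set φ := P.eval w / Q.eval w with hφ_def
    have hev : (Polynomial.C 2 * Q + Polynomial.X * P).eval w = Q.eval w * (2 + w * φ) := by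
      simp only [Polynomial.eval_add, Polynomial.eval_mul, Polynomial.eval_C, Polynomial.eval_X,
        hφ_def]
      field_simp
    have hd := hden w φ hw hφ
    have hne : 2 + w * φ ≠ 0 := norm_pos_iff.mp (by linarith)
    have hquot : (Polynomial.X * Q).eval w / (Polynomial.C 2 * Q + Polynomial.X * P).eval w =
        w / (2 + w * φ) := by
      rw [hev, Polynomial.eval_mul, Polynomial.eval_X]
      field_simp
    refine ⟨by rw [hev]; exact mul_ne_zero hQ hne, ?_, fun F hF1 hFw => ?_⟩
    · rw [hquot, norm_div]
      exact div_le_one_of_le₀ ((hw.trans hr.le).trans hd) (norm_nonneg _)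
    · have hdF := hden w F hw hF1
      have hneF : 2 + w * F ≠ 0 := norm_pos_iff.mp (by linarith)
      have e : w / (2 + w * φ) - F = - (w ^ 2 * (φ - F) / ((2 + w * φ) * (2 + w * F))) := by
        have hF' : F = w / (2 + w * F) := (eq_div_iff hneF).mpr hFw
        have : w / (2 + w * φ) - F = w / (2 + w * φ) - w / (2 + w * F) := by rw [← hF']
        rw [this]
        field_simp
        ring
      rw [hquot, e, norm_neg, norm_div, norm_mul, norm_mul, norm_pow]
      calc ‖w‖ ^ 2 * ‖φ - F‖ / (‖2 + w * φ‖ * ‖2 + w * F‖)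
          ≤ ‖w‖ ^ 2 * ‖φ - F‖ := div_le_self (by positivity) (one_le_mul_of_one_le_of_one_le hd hdF)
        _ ≤ r ^ 2 * (2 * (r ^ 2) ^ n) := by
            gcongr
            exact hF F hF1 hFw
        _ = 2 * (r ^ 2) ^ (n + 1) := by ring

lemma exists_isRational_memX_matchCost_le {δ : ℝ} (hδ : 0 < δ) :
    ∃ G : ℂ → ℂ, isRational G ∧ memX G ∧ matchCost G G ≤ √2 + δ := by
  set r : ℝ := 1 / (1 + δ / 2) with hr_def
  have hr0 : 0 < r := by positivity
  have hr1 : r < 1 := by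
    rw [hr_def, div_lt_one (by positivity)]
    linarith
  have hrinv : 1 / r - 1 = δ / 2 := by rw [hr_def]; field_simp; ring
  obtain ⟨n, hn⟩ := exists_pow_lt_of_lt_one (show 0 < δ / 4 by positivity)
    (show r ^ 2 < 1 by nlinarith)
  obtain ⟨P, Q, hP0, hP1, hPQ⟩ := exists_rational_approx hr1 n
  have hrC : (r : ℂ) ≠ 0 := by exact_mod_cast hr0.ne'
  have hrw : ∀ w ∈ ball (0 : ℂ) 1, ‖(r : ℂ) * w‖ ≤ r := by
    intro w hw
    rw [norm_mul, Complex.norm_real, Real.norm_of_nonneg hr0.le]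
    exact mul_le_of_le_one_right hr0.le (by simpa using (mem_ball_zero_iff.mp hw).le)
  set p : Polynomial ℂ := P.comp (Polynomial.C (r : ℂ) * Polynomial.X) with hp
  set q : Polynomial ℂ := Polynomial.C (r : ℂ) * Q.comp (Polynomial.C (r : ℂ) * Polynomial.X)
    with hq
  have hpe : ∀ w, p.eval w = P.eval (r * w) := fun w => by simp [hp, Polynomial.eval_comp]
  have hqe : ∀ w, q.eval w = r * Q.eval (r * w) := fun w => by simp [hq, Polynomial.eval_comp]
  have hq0 : ∀ w ∈ ball (0 : ℂ) 1, q.eval w ≠ 0 := fun w hw => by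
    rw [hqe]
    exact mul_ne_zero hrC (hPQ _ (hrw w hw)).1
  have hG : ∀ w, p.eval w / q.eval w = (1 / r : ℝ) * (P.eval (r * w) / Q.eval (r * w)) := by
    intro w
    rw [hpe, hqe]
    push_cast
    rw [mul_comm (r : ℂ) (Q.eval _), ← div_div]
    ring
  have hQ0 : Q.eval 0 ≠ 0 := (hPQ 0 (by simpa using hr0.le)).1
  refine ⟨fun w => p.eval w / q.eval w, ⟨p, q, hq0, fun _ _ => rfl⟩, ⟨?_, ⟨1 / r, ?_⟩, ?_, ?_⟩, ?_⟩
  · exact p.differentiable.differentiableOn.div q.differentiable.differentiableOn hq0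
  · intro w hw
    simp only [hG]
    rw [norm_mul, Complex.norm_real, Real.norm_of_nonneg (by positivity)]
    exact mul_le_of_le_one_right (by positivity) (hPQ _ (hrw w hw)).2.1
  · simp [hpe, hP0]
  · have hd := ((p.hasDerivAt 0).fun_div (q.hasDerivAt 0) (hq0 0 (by simp))).deriv
    rw [hd, hpe, hqe, mul_zero, hP0, zero_mul, sub_zero]
    have : p.derivative.eval 0 = r * P.derivative.eval 0 := by
      simp [hp, Polynomial.derivative_comp, Polynomial.eval_comp]
    rw [this, ← hP1]
    rw [← hP1] at hQ0
    have := right_ne_zero_of_mul hQ0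
    field_simp
  · refine csSup_le ((nonempty_ball.mpr one_pos).image _) ?_
    rintro _ ⟨w, hw, rfl⟩
    obtain ⟨-, hφ, hF⟩ := hPQ _ (hrw w hw)
    obtain ⟨F, hF1, hFw, hp, hm⟩ := exists_optimal_value ((hrw w hw).trans hr1.le)
    have hclose : ‖p.eval w / q.eval w - F‖ ≤ δ := by
      have e : p.eval w / q.eval w - F =
          ((1 / r - 1 : ℝ) : ℂ) * (P.eval (r * w) / Q.eval (r * w)) +
            (P.eval (r * w) / Q.eval (r * w) - F) := by
        rw [hG]; push_cast; ring
      rw [e]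
      refine (norm_add_le _ _).trans ?_
      rw [norm_mul, Complex.norm_real, hrinv, Real.norm_of_nonneg (by positivity)]
      have h1 := hF F hF1 hFw
      have h2 : δ / 2 * ‖P.eval (r * w) / Q.eval (r * w)‖ ≤ δ / 2 :=
        mul_le_of_le_one_right (by positivity) hφ
      linarith
    refine sigmaMax_symm_le ?_ ?_
    · calc ‖1 + p.eval w / q.eval w‖ = ‖(1 + F) + (p.eval w / q.eval w - F)‖ := by ring_nf
        _ ≤ √2 + δ := (norm_add_le _ _).trans (add_le_add hp hclose)
    · calc ‖1 - p.eval w / q.eval w‖ = ‖(1 - F) - (p.eval w / q.eval w - F)‖ := by ring_nf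
        _ ≤ √2 + δ := (norm_sub_le _ _).trans (add_le_add hm hclose)

theorem rational_infimum_sqrt_two_not_attained :
    IsGLB {x : ℝ | ∃ G₁ G₂ : ℂ → ℂ, isRational G₁ ∧ isRational G₂ ∧
        memX G₁ ∧ memX G₂ ∧ x = matchCost G₁ G₂} (Real.sqrt 2) ∧
    (∀ G₁ G₂ : ℂ → ℂ, isRational G₁ → isRational G₂ → memX G₁ → memX G₂ →
      matchCost G₁ G₂ ≠ Real.sqrt 2) := by
  refine ⟨⟨?_, ?_⟩, fun G₁ G₂ r₁ r₂ h₁ h₂ => (sqrt_two_lt_matchCost r₁ r₂ h₁ h₂).ne'⟩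
  · rintro _ ⟨G₁, G₂, r₁, r₂, h₁, h₂, rfl⟩
    exact (sqrt_two_lt_matchCost r₁ r₂ h₁ h₂).le
  · intro b hb
    refine le_of_forall_pos_le_add fun δ hδ => ?_
    obtain ⟨G, hr, hX, hG⟩ := exists_isRational_memX_matchCost_le hδ
    exact (hb ⟨G, G, hr, hr, hX, hX, rfl⟩).trans hG
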